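/- Let C be a nontrivial cyclic binary linear code of length n (i.e., over GF(2)) whose minimum distance d(C) is odd, and let C̄ be its extended code of length n + 1. Then the dual code (C̄)⊥ has minimum linear locality d(C). -/

import Mathlib

open scoped BigOperators

variable {F : Type*} [Field F] {ι : Type*} [Fintype ι]

/-- The Hamming weight of a word: the number of nonzero coordinates. -/
noncomputable def wt (c : ι → F) : ℕ := {i | c i ≠ 0}.ncard

/-- The minimum distance of a linear code: the least Hamming weight of a nonzero codeword. -/
noncomputable def minDist (C : Submodule F (ι → F)) : ℕ :=
  sInf {w | ∃ c ∈ C, c ≠ 0 ∧ wt c = w}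

/-- The dual code of a linear code. -/
def dualCode (C : Submodule F (ι → F)) : Submodule F (ι → F) where
  carrier := {x | ∀ c ∈ C, ∑ i, x i * c i = 0}
  add_mem' := by
    intro a b ha hb c hc
    have h1 := ha c hc
    have h2 := hb c hc
    simp only [Set.mem_setOf_eq, Pi.add_apply, add_mul, Finset.sum_add_distrib, h1, h2, add_zero]
  zero_mem' := by intro c hc; simp
  smul_mem' := by
    intro r a ha c hc
    have h := ha c hc
    simp only [Set.mem_setOf_eq, Pi.smul_apply, smul_eq_mul, mul_assoc, ← Finset.mul_sum, h,
      mul_zero]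

/-- `C` has linear locality `r`: every code symbol `c i` is a fixed linear combination of
at most `r` other code symbols. -/
def HasLinearLocality (C : Submodule F (ι → F)) (r : ℕ) : Prop :=
  ∀ i : ι, ∃ (R : Finset ι) (u : ι → F), i ∉ R ∧ R.card ≤ r ∧
    ∀ c ∈ C, c i = ∑ j ∈ R, u j * c j

/-- The extended code of a code of length `n`: append an overall parity-check coordinate. -/
def extendedCode {n : ℕ} (C : Submodule F (Fin n → F)) : Submodule F (Fin (n + 1) → F) where
  carrier := {x | (fun i : Fin n => x i.castSucc) ∈ C ∧ ∑ i, x i = 0}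
  add_mem' := by
    rintro a b ⟨ha1, ha2⟩ ⟨hb1, hb2⟩
    exact ⟨C.add_mem ha1 hb1, by simp [Finset.sum_add_distrib, ha2, hb2]⟩
  zero_mem' := ⟨C.zero_mem, by simp⟩
  smul_mem' := by
    rintro r a ⟨ha1, ha2⟩
    exact ⟨C.smul_mem r ha1, by
      simp only [Pi.smul_apply, smul_eq_mul, ← Finset.mul_sum, ha2, mul_zero]⟩

lemma minDist_le_wt {κ : Type*} {C : Submodule F (κ → F)} {c : κ → F} (hc : c ∈ C)
    (h0 : c ≠ 0) :
    minDist C ≤ wt c :=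
  Nat.sInf_le ⟨c, hc, h0, rfl⟩

lemma exists_wt_eq_minDist {κ : Type*} {C : Submodule F (κ → F)} (h : minDist C ≠ 0) :
    ∃ c ∈ C, wt c = minDist C := by
  obtain ⟨c, hc, -, hw⟩ := Nat.sInf_mem (Nat.nonempty_of_sInf_eq_succ (Nat.succ_pred h).symm)
  exact ⟨c, hc, hw⟩

lemma dualCode_dualCode_le (C : Submodule F (ι → F)) : dualCode (dualCode C) ≤ C := by
  classical
  intro z hz
  by_contra hzC
  obtain ⟨f, hfz, hfC⟩ := Submodule.exists_le_ker_of_notMem hzC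
  have hf (x : ι → F) : f x = ∑ i, x i * f (Pi.single i 1) := by
    conv_lhs => rw [← Finset.univ_sum_single x, map_sum]
    refine Finset.sum_congr rfl fun i _ => ?_
    rw [← smul_eq_mul, ← map_smul, ← Pi.single_smul, smul_eq_mul, mul_one]
  refine hfz ((hf z).trans (hz (fun i => f (Pi.single i 1)) fun c hc => ?_))
  simpa [mul_comm, ← hf] using hfC hc

/-- A codeword that does not vanish at `i` gives a recovery rule for the coordinate `i` of the
dual code, using the other coordinates of its support. -/
lemma exists_recovery_of_mem {C : Submodule F (ι → F)} {x : ι → F} (hx : x ∈ C) {i : ι}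
    (hi : x i ≠ 0) :
    ∃ (R : Finset ι) (u : ι → F), i ∉ R ∧ R.card + 1 = wt x ∧
      ∀ y ∈ dualCode C, y i = ∑ j ∈ R, u j * y j := by
  classical
  have hmem : i ∈ Finset.univ.filter fun j => x j ≠ 0 := by simpa using hi
  refine ⟨(Finset.univ.filter fun j => x j ≠ 0).erase i, fun j => -(x i)⁻¹ * x j, by simp, ?_, ?_⟩
  · rw [Finset.card_erase_add_one hmem, wt, ← Set.ncard_coe_finset]
    simp
  · intro y hy
    have h := hy x hx
    have hs : ∑ j ∈ Finset.univ.filter (fun j => x j ≠ 0), y j * x j = 0 := by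
      rwa [Finset.sum_filter_of_ne fun j _ hj => right_ne_zero_of_mul hj]
    rw [← Finset.add_sum_erase _ _ hmem] at hs
    have hs' := eq_neg_of_add_eq_zero_left hs
    calc y i = (x i)⁻¹ * (y i * x i) := by field_simp
      _ = _ := by
        rw [hs', mul_neg, ← neg_mul, Finset.mul_sum]
        exact Finset.sum_congr rfl fun j _ => by ring

/-- A recovery rule for the coordinate `i` of the dual code comes from a codeword that is `1` at
`i` and is supported on `i` together with the recovery set. -/
lemma exists_mem_of_recovery {C : Submodule F (ι → F)} {i : ι} {R : Finset ι} {u : ι → F}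
    (hi : i ∉ R) (h : ∀ y ∈ dualCode C, y i = ∑ j ∈ R, u j * y j) :
    ∃ z ∈ C, z i = 1 ∧ ∀ j, j ≠ i → z j ≠ 0 → j ∈ R := by
  classical
  refine ⟨fun j => (if j = i then 1 else 0) - if j ∈ R then u j else 0,
    dualCode_dualCode_le C fun y hy => ?_, by simp [hi], fun j hj hz => ?_⟩
  · simp [sub_mul, Finset.sum_sub_distrib, ite_mul, h y hy]
  · by_contra hR
    simp [hj, hR] at hz

lemma minDist_le_of_hasLinearLocality {n : ℕ} {C : Submodule F (Fin n → F)} {r : ℕ}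
    (h : HasLinearLocality (dualCode (extendedCode C)) r) : minDist C ≤ r := by
  obtain ⟨R, u, hi, hR, hu⟩ := h (Fin.last n)
  obtain ⟨z, ⟨hzC, hz0⟩, hz1, hzR⟩ := exists_mem_of_recovery hi hu
  refine (minDist_le_wt hzC fun h0 => ?_).trans (le_trans ?_ hR)
  · have hz (i : Fin n) : z i.castSucc = 0 := congrFun h0 i
    simp [Fin.sum_univ_castSucc, hz, hz1] at hz0
  · rw [wt, ← Set.ncard_coe_finset R]
    exact Set.ncard_le_ncard_of_injOn Fin.castSucc
      (fun i hi' => hzR _ (Fin.castSucc_ne_last i) hi')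
      (Fin.castSucc_injective n).injOn

lemma sum_eq_one_of_odd_wt {c : ι → ZMod 2} (h : Odd (wt c)) : ∑ i, c i = 1 := by
  classical
  have hc (i : ι) : c i = if c i ≠ 0 then 1 else 0 := by
    generalize c i = a
    revert a
    decide
  have hw : wt c = (Finset.univ.filter fun i => c i ≠ 0).card := by
    rw [wt, ← Set.ncard_coe_finset]
    simp
  rw [Finset.sum_congr rfl fun i _ => hc i, Finset.sum_boole, ← hw]
  exact ZMod.natCast_eq_one_iff_odd.mpr h

lemma snoc_mem_extendedCode {n : ℕ} {C : Submodule (ZMod 2) (Fin n → ZMod 2)}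
    {c : Fin n → ZMod 2} (hc : c ∈ C) (hodd : Odd (wt c)) :
    (Fin.snoc c 1 : Fin (n + 1) → ZMod 2) ∈ extendedCode C := by
  refine ⟨by simpa using hc, ?_⟩
  rw [Fin.sum_univ_castSucc]
  simp only [Fin.snoc_castSucc, Fin.snoc_last, sum_eq_one_of_odd_wt hodd]
  decide

lemma wt_snoc_one_le {n : ℕ} (c : Fin n → F) :
    wt (Fin.snoc c 1 : Fin (n + 1) → F) ≤ wt c + 1 := by
  have hs : {i | (Fin.snoc c 1 : Fin (n + 1) → F) i ≠ 0} ⊆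
      insert (Fin.last n) (Fin.castSucc '' {i | c i ≠ 0}) := by
    intro i
    induction i using Fin.lastCases <;> simp
  exact (Set.ncard_le_ncard hs).trans ((Set.ncard_insert_le _ _).trans
    (Nat.add_le_add_right (Set.ncard_image_le) 1))

lemma shift_mem {n : ℕ} [NeZero n] {C : Submodule F (Fin n → F)}
    (hcyc : ∀ c ∈ C, (fun i : Fin n => c (i - 1)) ∈ C) {c : Fin n → F} (hc : c ∈ C)
    (k : Fin n) : (fun i => c (i - k)) ∈ C := by
  have h (m : ℕ) : (fun i : Fin n => c (i - Fin.ofNat n m)) ∈ C := by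
    induction m with
    | zero => simpa using hc
    | succ m ih =>
      convert hcyc _ ih using 3 with i
      rw [sub_sub, show Fin.ofNat n (m + 1) = 1 + Fin.ofNat n m by
        ext; simp [Fin.val_add, add_comm]]
  simpa using h k

lemma wt_shift {n : ℕ} [NeZero n] (c : Fin n → F) (k : Fin n) :
    wt (fun i => c (i - k)) = wt c :=
  Set.ncard_preimage_of_injective_subset_range (s := {i | c i ≠ 0}) (sub_left_injective (b := k))
    fun i _ => ⟨i + k, add_sub_cancel_right i k⟩

/-- Let `C` be a nontrivial binary cyclic code whose minimum distance is odd.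
Then the dual of the extended code `C̄` has minimum linear locality `d(C)`. -/
theorem statement7 {n : ℕ} [NeZero n] (C : Submodule (ZMod 2) (Fin n → ZMod 2))
    (hcyc : ∀ c ∈ C, (fun i : Fin n => c (i - 1)) ∈ C)
    (h1 : 2 ≤ minDist C) (h2 : 2 ≤ minDist (dualCode C))
    (hodd : Odd (minDist C)) :
    IsLeast {r : ℕ | HasLinearLocality (dualCode (extendedCode C)) r} (minDist C) := by
  refine ⟨fun i => ?_, fun r hr => minDist_le_of_hasLinearLocality hr⟩
  obtain ⟨c, hc, hw⟩ := exists_wt_eq_minDist (C := C) (by omega)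
  obtain ⟨j, hj⟩ : ∃ j, c j ≠ 0 := by
    by_contra! h0
    simp [wt, h0] at hw
    omega
  obtain ⟨b, hb, hbw, hbi⟩ : ∃ b ∈ C, wt b = minDist C ∧
      (Fin.snoc b 1 : Fin (n + 1) → ZMod 2) i ≠ 0 := by
    induction i using Fin.lastCases with
    | last => exact ⟨c, hc, hw, by simp⟩
    | cast i =>
      refine ⟨_, shift_mem hcyc hc (i - j), (wt_shift c _).trans hw, ?_⟩
      rw [Fin.snoc_castSucc]
      simpa using hj
  obtain ⟨R, u, hiR, hR, hu⟩ :=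
    exists_recovery_of_mem (snoc_mem_extendedCode hb (hbw ▸ hodd)) hbi
  have hle := wt_snoc_one_le b
  exact ⟨R, u, hiR, by omega, hu⟩
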